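/- Let ℍ² := {τ ∈ ℂ : Im τ > 0}, and define Φ : ℍ² × ℝ → ℝ³ by Φ(τ,ρ) := (e^ρ/(2·Im τ))·(τ + τ̄, |τ|² − 1, |τ|² + 1), where the first component τ + τ̄ = 2·Re τ is real. Let Q(x,y,t) := t² − x² − y² and f(p) := −(1/2)·log(Q(p)) on Ω := {Q > 0}. Then for every (τ,ρ) ∈ ℍ² × ℝ and all tangent vectors (a, s), (b, r) ∈ ℂ × ℝ, D²f(Φ(τ,ρ))( DΦ(τ,ρ)(a,s), DΦ(τ,ρ)(b,r) ) = s·r + Re(a·conj(b))/(Im τ)². (That is, Φ pulls back the Hessian metric of f on the cone Ω to the product metric dρ² + |dτ|²/Im(τ)² on ℍ² × ℝ; Φ is an isometry onto its image.) -/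

import Mathlib

/-- The Lorentzian quadratic form `Q(x,y,t) = t² − x² − y²` on `ℝ³`. -/
def Qform (p : ℝ × ℝ × ℝ) : ℝ := p.2.2 ^ 2 - p.1 ^ 2 - p.2.1 ^ 2

/-- The potential `f = −(1/2)·log Q` on the cone `{Q > 0}`. -/
noncomputable def fpot (p : ℝ × ℝ × ℝ) : ℝ := -(1 / 2) * Real.log (Qform p)

/-- The map `Φ(τ,ρ) = (e^ρ/(2·Im τ))·(τ + τ̄, |τ|² − 1, |τ|² + 1)` from
`ℍ² × ℝ` to the cone `Ω = {Q > 0}`. -/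
noncomputable def Φmap (q : ℂ × ℝ) : ℝ × ℝ × ℝ :=
  ((Real.exp q.2 / (2 * q.1.im)) * (2 * q.1.re),
   (Real.exp q.2 / (2 * q.1.im)) * (Complex.normSq q.1 - 1),
   (Real.exp q.2 / (2 * q.1.im)) * (Complex.normSq q.1 + 1))

open Topology

/-- The polar form of `Qform`, as a continuous bilinear map. -/
noncomputable def lorentzForm : (ℝ × ℝ × ℝ) →L[ℝ] (ℝ × ℝ × ℝ) →L[ℝ] ℝ :=
  let x := ContinuousLinearMap.fst ℝ ℝ (ℝ × ℝ)
  let y := (ContinuousLinearMap.fst ℝ ℝ ℝ).comp (ContinuousLinearMap.snd ℝ ℝ (ℝ × ℝ))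
  let t := (ContinuousLinearMap.snd ℝ ℝ ℝ).comp (ContinuousLinearMap.snd ℝ ℝ (ℝ × ℝ))
  t.smulRight t - x.smulRight x - y.smulRight y

theorem lorentzForm_apply (p v : ℝ × ℝ × ℝ) :
    lorentzForm p v = p.2.2 * v.2.2 - p.1 * v.1 - p.2.1 * v.2.1 := by
  simp [lorentzForm]

theorem hasFDerivAt_Qform (p : ℝ × ℝ × ℝ) :
    HasFDerivAt Qform ((2 : ℝ) • lorentzForm p) p := by
  have hx : HasFDerivAt (fun q : ℝ × ℝ × ℝ => q.1) _ p := hasFDerivAt_fst (𝕜 := ℝ)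
  have hyt : HasFDerivAt (fun q : ℝ × ℝ × ℝ => q.2) _ p := hasFDerivAt_snd (𝕜 := ℝ)
  refine (((hyt.snd.pow 2).sub (hx.pow 2)).sub (hyt.fst.pow 2)).congr_fderiv ?_
  ext <;> simp [lorentzForm_apply]

theorem hasFDerivAt_fpot {p : ℝ × ℝ × ℝ} (hp : Qform p ≠ 0) :
    HasFDerivAt fpot (-(Qform p)⁻¹ • lorentzForm p) p := by
  refine (((hasFDerivAt_Qform p).log hp).const_mul (-(1 / 2))).congr_fderiv ?_
  ext <;> simp <;> ring

theorem fderiv_fderiv_fpot {p : ℝ × ℝ × ℝ} (hp : Qform p ≠ 0) (u v : ℝ × ℝ × ℝ) :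
    fderiv ℝ (fderiv ℝ fpot) p u v =
      2 * lorentzForm p u * lorentzForm p v / Qform p ^ 2 - lorentzForm u v / Qform p := by
  have hev : fderiv ℝ fpot =ᶠ[𝓝 p] fun q => -(Qform q)⁻¹ • lorentzForm q := by
    filter_upwards [(hasFDerivAt_Qform p).continuousAt.eventually_ne hp] with q hq
    exact (hasFDerivAt_fpot hq).fderiv
  have hinv : HasFDerivAt (fun q => -(Qform q)⁻¹) _ p :=
    (((hasDerivAt_inv hp).comp_hasFDerivAt p (hasFDerivAt_Qform p))).neg
  have hsmul : HasFDerivAt (fun q => -(Qform q)⁻¹ • lorentzForm q) _ p :=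
    hinv.smul lorentzForm.hasFDerivAt
  rw [hev.fderiv_eq, hsmul.fderiv]
  simp
  field_simp
  ring

theorem Qform_Φmap {τ : ℂ} (hτ : τ.im ≠ 0) (ρ : ℝ) :
    Qform (Φmap (τ, ρ)) = Real.exp ρ ^ 2 := by
  simp only [Qform, Φmap, Complex.normSq_apply]
  field_simp
  ring

theorem fderiv_Φmap {τ : ℂ} (hτ : τ.im ≠ 0) (ρ : ℝ) (a : ℂ) (s : ℝ) :
    fderiv ℝ Φmap (τ, ρ) (a, s) =
      (Real.exp ρ / (2 * τ.im)) •
        ((s - a.im / τ.im) * (2 * τ.re) + 2 * a.re,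
         (s - a.im / τ.im) * (Complex.normSq τ - 1) + 2 * (τ.re * a.re + τ.im * a.im),
         (s - a.im / τ.im) * (Complex.normSq τ + 1) + 2 * (τ.re * a.re + τ.im * a.im)) := by
  have hfst : HasFDerivAt (fun q : ℂ × ℝ => q.1) _ (τ, ρ) := hasFDerivAt_fst (𝕜 := ℝ)
  have hre : HasFDerivAt (fun q : ℂ × ℝ => q.1.re) _ (τ, ρ) :=
    Complex.reCLM.hasFDerivAt.comp _ hfst
  have him : HasFDerivAt (fun q : ℂ × ℝ => q.1.im) _ (τ, ρ) :=
    Complex.imCLM.hasFDerivAt.comp _ hfst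
  have hexp : HasFDerivAt (fun q : ℂ × ℝ => Real.exp q.2) _ (τ, ρ) :=
    HasFDerivAt.exp hasFDerivAt_snd
  have hscale : HasFDerivAt (fun q : ℂ × ℝ => Real.exp q.2 / (2 * q.1.im)) _ (τ, ρ) :=
    hexp.mul ((hasDerivAt_inv (mul_ne_zero two_ne_zero hτ)).comp_hasFDerivAt (τ, ρ)
      (him.const_mul 2))
  have hnorm : HasFDerivAt (fun q : ℂ × ℝ => Complex.normSq q.1) _ (τ, ρ) :=
    (hre.mul hre).add (him.mul him)
  have hΦ : HasFDerivAt Φmap _ (τ, ρ) :=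
    (hscale.mul (hre.const_mul 2)).prodMk
      ((hscale.mul (hnorm.sub_const 1)).prodMk (hscale.mul (hnorm.add_const 1)))
  rw [hΦ.fderiv]
  ext <;> simp <;> field_simp <;> ring

/-- `Φ` pulls back the Hessian metric of `f = −(1/2)·log Q` on the cone `{Q > 0}` to
the product metric `dρ² + |dτ|²/Im(τ)²` on `ℍ² × ℝ`. -/
theorem stmt10 : ∀ (τ : ℂ) (ρ : ℝ), 0 < τ.im → ∀ (a b : ℂ) (s r : ℝ),
    fderiv ℝ (fderiv ℝ fpot) (Φmap (τ, ρ))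
        (fderiv ℝ Φmap (τ, ρ) (a, s)) (fderiv ℝ Φmap (τ, ρ) (b, r))
      = s * r + (a * (starRingEnd ℂ) b).re / τ.im ^ 2 := by
  intro τ ρ hτ a b s r
  have hQ := Qform_Φmap hτ.ne' ρ
  have hexp := Real.exp_ne_zero ρ
  rw [fderiv_fderiv_fpot (hQ ▸ pow_ne_zero 2 hexp), hQ, fderiv_Φmap hτ.ne', fderiv_Φmap hτ.ne']
  simp only [lorentzForm_apply, Φmap, Complex.normSq_apply, Prod.smul_mk, smul_eq_mul,
    Complex.mul_re, Complex.conj_re, Complex.conj_im]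
  field_simp
  ring
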